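/- arXiv:1109.6179 — 2 statements merged into one kernel-verified Lean document; each statement's English description precedes it below -/
import Mathlib

section
/- Separation of polyhedra along a facet: let P, Q ⊆ ℝ^d be polyhedra with dim(P) = d, Q ≠ ∅, int(P) ∩ Q = ∅, and suppose G is a facet of P with relint(G) ∩ Q = ∅. Then there exists a closed halfspace H ⊆ ℝ^d with P ⊆ H, relint(G) ⊆ int(H), and Q ∩ int(H) = ∅. -/
def IsFreeSet {d : ℕ} (S L : Set (Fin d → ℝ)) : Prop :=
  IsClosed L ∧ Convex ℝ L ∧ interior L ∩ S = ∅

def IsMaxFree {d : ℕ} (S L : Set (Fin d → ℝ)) : Prop :=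
  IsFreeSet S L ∧ ∀ L', IsFreeSet S L' → L ⊆ L' → L' = L

def IsPolyhedron {d : ℕ} (P : Set (Fin d → ℝ)) : Prop :=
  ∃ (m : ℕ) (u : Fin m → ((Fin d → ℝ) →ₗ[ℝ] ℝ)) (b : Fin m → ℝ),
    P = {x | ∀ i, u i x ≤ b i}

def FullDim {d : ℕ} (A : Set (Fin d → ℝ)) : Prop := affineSpan ℝ A = ⊤

noncomputable def adim {d : ℕ} (A : Set (Fin d → ℝ)) : ℕ :=
  Module.finrank ℝ (affineSpan ℝ A).direction

def IsFacet {d : ℕ} (P F : Set (Fin d → ℝ)) : Prop :=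
  F.Nonempty ∧ IsExposed ℝ P F ∧ adim F + 1 = d

def FacetsLE {d : ℕ} (P : Set (Fin d → ℝ)) (k : ℕ) : Prop :=
  {F : Set (Fin d → ℝ) | IsFacet P F}.encard ≤ (k : ℕ∞)

theorem farkas_aux {V ι : Type*} [AddCommGroup V] [Module ℝ V] [DecidableEq ι] (s : Finset ι) :
    ∀ (f : ι → V →ₗ[ℝ] ℝ) (g : V →ₗ[ℝ] ℝ),
      (∀ x, (∀ i ∈ s, f i x ≤ 0) → g x ≤ 0) →
      ∃ c : ι → ℝ, (∀ i, 0 ≤ c i) ∧ ∀ x, g x = ∑ i ∈ s, c i * f i x := by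
  induction s using Finset.induction_on with
  | empty =>
    intro f g h
    refine ⟨fun _ => 0, fun _ => le_rfl, fun x => ?_⟩
    have h1 := h x (by simp)
    have h2 := h (-x) (by simp)
    simp only [map_neg] at h2
    simp only [Finset.sum_empty]
    linarith
  | insert a s ha ih =>
    intro f g h
    by_cases hg : ∀ x, (∀ i ∈ s, f i x ≤ 0) → g x ≤ 0
    · obtain ⟨c, hc, hcg⟩ := ih f g hg
      refine ⟨fun i => if i = a then 0 else c i, fun i => ?_, fun x => ?_⟩
      · dsimp only
        split_ifs
        · exact le_rfl
        · exact hc i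
      · rw [Finset.sum_insert ha, hcg x]
        simp only [if_true, zero_mul, zero_add]
        refine Finset.sum_congr rfl fun i hi => ?_
        rw [if_neg (ne_of_mem_of_not_mem hi ha)]
    · push Not at hg
      obtain ⟨z, hz, hgz⟩ := hg
      have hz0 : 0 < f a z := by
        by_contra hcon
        push Not at hcon
        refine absurd (h z fun i hi => ?_) (not_le.2 hgz)
        rcases Finset.mem_insert.1 hi with rfl | hi
        · exact hcon
        · exact hz i hi
      set r := (f a z)⁻¹ with hr
      have hr0 : 0 < r := inv_pos.2 hz0
      have hrz : r * f a z = 1 := inv_mul_cancel₀ hz0.ne'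
      obtain ⟨c, hc, hcg⟩ := ih (fun i => f i - (r * f i z) • f a) (g - (r * g z) • f a) (by
        intro x hx
        have := h (x - (r * f a x) • z) (by
          intro i hi
          rcases Finset.mem_insert.1 hi with rfl | hi
          · simp only [map_sub, map_smul, smul_eq_mul]
            have : r * f i x * f i z = f i x := by linear_combination f i x * hrz
            linarith
          · have := hx i hi
            simp only [LinearMap.sub_apply, LinearMap.smul_apply, map_sub, map_smul,
              smul_eq_mul] at this ⊢
            linarith)
        simp only [LinearMap.sub_apply, LinearMap.smul_apply, map_sub, map_smul,
              smul_eq_mul] at this ⊢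
        linarith)
      have hs : ∑ i ∈ s, c i * f i z ≤ 0 :=
        Finset.sum_nonpos fun i hi => mul_nonpos_of_nonneg_of_nonpos (hc i) (hz i hi)
      refine ⟨fun i => if i = a then r * (g z - ∑ i ∈ s, c i * f i z) else c i,
        fun i => ?_, fun x => ?_⟩
      · dsimp only
        split_ifs
        · exact mul_nonneg hr0.le (by linarith)
        · exact hc i
      · rw [Finset.sum_insert ha]
        have e : ∑ i ∈ s, (if i = a then r * (g z - ∑ i ∈ s, c i * f i z) else c i) * f i x
            = ∑ i ∈ s, c i * f i x := by
          refine Finset.sum_congr rfl fun i hi => ?_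
          rw [if_neg (ne_of_mem_of_not_mem hi ha)]
        rw [e]
        have := hcg x
        simp only [LinearMap.sub_apply, LinearMap.smul_apply, smul_eq_mul] at this
        have e2 : ∑ i ∈ s, c i * (f i x - r * f i z * f a x)
            = ∑ i ∈ s, c i * f i x - r * f a x * ∑ i ∈ s, c i * f i z := by
          rw [Finset.mul_sum, ← Finset.sum_sub_distrib]
          refine Finset.sum_congr rfl fun i hi => ?_
          ring
        rw [e2] at this
        simp only [if_true]
        linarith

/-- Motzkin-type transposition theorem. -/
theorem motzkin_aux {V : Type*} [AddCommGroup V] [Module ℝ V] {m n : ℕ}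
    (u : Fin m → V →ₗ[ℝ] ℝ) (b : Fin m → ℝ) (e : Fin m → ℝ) (he : ∀ i, e i = 0 ∨ e i = 1)
    (v : Fin n → V →ₗ[ℝ] ℝ) (c : Fin n → ℝ)
    (h : ∀ x, (∀ i, u i x ≤ b i) → (∀ i, e i = 1 → u i x < b i) → (∀ j, v j x ≤ c j) → False) :
    ∃ (ν : Fin m → ℝ) (μ : Fin n → ℝ) (ρ : ℝ), (∀ i, 0 ≤ ν i) ∧ (∀ j, 0 ≤ μ j) ∧ 0 ≤ ρ ∧
      (∀ x, ∑ i, ν i * u i x + ∑ j, μ j * v j x = 0) ∧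
      (∑ i, ν i * e i + ρ = 1) ∧ (∑ i, ν i * b i + ∑ j, μ j * c j + ρ = 0) := by
  let X : (V × ℝ × ℝ) →ₗ[ℝ] V := LinearMap.fst ℝ V (ℝ × ℝ)
  let S : (V × ℝ × ℝ) →ₗ[ℝ] ℝ := LinearMap.fst ℝ ℝ ℝ ∘ₗ LinearMap.snd ℝ V (ℝ × ℝ)
  let T : (V × ℝ × ℝ) →ₗ[ℝ] ℝ := LinearMap.snd ℝ ℝ ℝ ∘ₗ LinearMap.snd ℝ V (ℝ × ℝ)
  let f : Fin m ⊕ Fin n ⊕ Unit → (V × ℝ × ℝ) →ₗ[ℝ] ℝ :=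
    Sum.elim (fun i => u i ∘ₗ X + e i • S - b i • T)
      (Sum.elim (fun j => v j ∘ₗ X - c j • T) (fun _ => S - T))
  obtain ⟨k, hk, hkg⟩ := farkas_aux Finset.univ f S (by
    rintro ⟨x, s, t⟩ hx
    by_contra hs
    have h1 : ∀ i, u i x + e i * s - b i * t ≤ 0 := fun i => hx (Sum.inl i) (Finset.mem_univ _)
    have h2 : ∀ j, v j x - c j * t ≤ 0 := fun j => hx (Sum.inr (Sum.inl j)) (Finset.mem_univ _)
    have h3 : s - t ≤ 0 := hx (Sum.inr (Sum.inr ())) (Finset.mem_univ _)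
    have hs : 0 < s := not_le.1 hs
    have ht : 0 < t := by linarith
    refine h (t⁻¹ • x) (fun i => ?_) (fun i hi => ?_) (fun j => ?_)
    · rw [map_smul, smul_eq_mul, inv_mul_le_iff₀ ht]
      rcases he i with hi | hi <;> have := h1 i <;> rw [hi] at this <;> linarith
    · rw [map_smul, smul_eq_mul, inv_mul_lt_iff₀ ht]
      have := h1 i
      rw [hi] at this
      linarith
    · rw [map_smul, smul_eq_mul, inv_mul_le_iff₀ ht]
      have := h2 j
      linarith)
  have key : ∀ x s t, s = ∑ i, k (Sum.inl i) * (u i x + e i * s - b i * t)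
      + (∑ j, k (Sum.inr (Sum.inl j)) * (v j x - c j * t) + k (Sum.inr (Sum.inr ())) * (s - t)) := by
    intro x s t
    have := hkg (x, s, t)
    simpa [f, X, S, T, Fintype.sum_sum_type] using this
  refine ⟨fun i => k (Sum.inl i), fun j => k (Sum.inr (Sum.inl j)), k (Sum.inr (Sum.inr ())),
    fun _ => hk _, fun _ => hk _, hk _, fun x => ?_, ?_, ?_⟩
  · have := key x 0 0
    simp only [mul_zero, add_zero, sub_zero] at this
    exact this.symm
  · have := key 0 1 0
    simp only [map_zero, mul_zero, zero_add, sub_zero, mul_one, Finset.sum_const_zero] at this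
    exact this.symm
  · have := key 0 0 1
    simp only [map_zero, mul_zero, zero_add, zero_sub, mul_one, mul_neg, Finset.sum_neg_distrib] at this
    linarith

theorem relint_strict {d : ℕ} {G : Set (Fin d → ℝ)} (u : (Fin d → ℝ) →ₗ[ℝ] ℝ) (b : ℝ)
    (hle : ∀ y ∈ G, u y ≤ b) {g : Fin d → ℝ} (hg : g ∈ G) (hlt : u g < b)
    {x : Fin d → ℝ} (hx : x ∈ intrinsicInterior ℝ G) : u x < b := by
  obtain ⟨y, hy, rfl⟩ := mem_intrinsicInterior.1 hx
  have hgs : g ∈ affineSpan ℝ G := subset_affineSpan ℝ G hg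
  let φ : ℝ → affineSpan ℝ G := fun t =>
    ⟨AffineMap.lineMap (y : Fin d → ℝ) g t, AffineMap.lineMap_mem t y.2 hgs⟩
  have hφ : Continuous φ := Continuous.subtype_mk (by fun_prop) _
  have h0 : φ 0 = y := Subtype.ext (by simp [φ])
  have hev : ∀ᶠ t in nhds (0 : ℝ), φ t ∈ ((↑) ⁻¹' G : Set (affineSpan ℝ G)) := by
    apply hφ.continuousAt.eventually_mem
    rw [h0]
    exact mem_interior_iff_mem_nhds.1 hy
  obtain ⟨ε, hε, hball⟩ := Metric.eventually_nhds_iff.1 hev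
  have hm := hball (y := -(ε/2)) (by rw [Real.dist_eq]; rw [abs_lt]; constructor <;> linarith)
  have hm2 : u (AffineMap.lineMap (y : Fin d → ℝ) g (-(ε/2))) ≤ b := hle _ hm
  rw [AffineMap.lineMap_apply] at hm2
  simp only [vsub_eq_sub, vadd_eq_add, map_add, map_smul, map_sub, smul_eq_mul] at hm2
  by_contra hcon
  push Not at hcon
  nlinarith

theorem facet_separation {d : ℕ} (P Q G : Set (Fin d → ℝ))
    (hP : IsPolyhedron P) (hQ : IsPolyhedron Q) (hPdim : FullDim P)
    (hQne : Q.Nonempty) (hdisj : interior P ∩ Q = ∅)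
    (hG : IsFacet P G) (hGQ : intrinsicInterior ℝ G ∩ Q = ∅) :
    ∃ (u : (Fin d → ℝ) →ₗ[ℝ] ℝ) (b : ℝ), u ≠ 0 ∧
      P ⊆ {x | u x ≤ b} ∧
      intrinsicInterior ℝ G ⊆ {x | u x < b} ∧
      Q ∩ {x | u x < b} = ∅ := by
  classical
  obtain ⟨m, u, b, hPe⟩ := hP
  obtain ⟨n, v, c, hQe⟩ := hQ
  obtain ⟨⟨g0, hg0⟩, hexp, hdim⟩ := hG
  obtain ⟨w, hw⟩ := hexp ⟨g0, hg0⟩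
  have hPm : ∀ x, x ∈ P ↔ ∀ i, u i x ≤ b i := fun x => by rw [hPe]; rfl
  have hQm : ∀ x, x ∈ Q ↔ ∀ j, v j x ≤ c j := fun x => by rw [hQe]; rfl
  have hGm : ∀ x, x ∈ G ↔ x ∈ P ∧ ∀ y ∈ P, w y ≤ w x := fun x => by
    conv_lhs => rw [hw]
    rfl
  have hGP : ∀ x ∈ G, x ∈ P := fun x hx => ((hGm x).1 hx).1
  have hwle : ∀ y ∈ P, w y ≤ w g0 := ((hGm g0).1 hg0).2
  have hwG : ∀ y ∈ G, w y = w g0 := fun y hy =>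
    le_antisymm (hwle y (hGP y hy)) (((hGm y).1 hy).2 g0 (hGP g0 hg0))
  have hGmem : ∀ y ∈ P, w y = w g0 → y ∈ G := fun y hy h =>
    (hGm y).2 ⟨hy, fun z hz => by rw [h]; exact hwle z hz⟩
  obtain ⟨p, hpP, hpG⟩ : ∃ p ∈ P, p ∉ G := by
    by_contra hcon
    push Not at hcon
    have : G = P := Set.Subset.antisymm hGP hcon
    rw [this] at hdim
    unfold adim at hdim
    rw [show affineSpan ℝ P = ⊤ from hPdim, AffineSubspace.direction_top, finrank_top] at hdim
    simp at hdim
  have hpw : w p < w g0 := lt_of_le_of_ne (hwle p hpP) fun h => hpG (hGmem p hpP h)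
  -- the affine span of G lies in the hyperplane
  have hspan : ∀ (l : (Fin d → ℝ) →ₗ[ℝ] ℝ) (β : ℝ), (∀ y ∈ G, l y = β) →
      (affineSpan ℝ G).direction ≤ LinearMap.ker l := by
    intro l β hl
    rw [direction_affineSpan]
    refine Submodule.span_le.2 ?_
    rintro _ ⟨y, hy, z, hz, rfl⟩
    simp [hl y hy, hl z hz]
  have hker : (affineSpan ℝ G).direction = LinearMap.ker (w : (Fin d → ℝ) →ₗ[ℝ] ℝ) := by
    apply Submodule.eq_of_le_of_finrank_le (hspan w (w g0) hwG)
    have h1 := LinearMap.finrank_range_add_finrank_ker (w : (Fin d → ℝ) →ₗ[ℝ] ℝ)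
    have h2 : LinearMap.range (w : (Fin d → ℝ) →ₗ[ℝ] ℝ) = ⊤ := by
      apply LinearMap.range_eq_top.2
      apply LinearMap.surjective
      intro h0
      have e1 : ∀ x, w x = 0 := fun x => LinearMap.congr_fun h0 x
      rw [e1, e1] at hpw
      exact lt_irrefl _ hpw
    rw [h2] at h1
    simp only [finrank_top, Module.finrank_self, Module.finrank_fin_fun] at h1
    unfold adim at hdim
    omega
  -- tight constraints are nonnegative multiples
  have htight : ∀ i, (∀ y ∈ G, u i y = b i) →
      ∃ l : ℝ, 0 ≤ l ∧ ∀ x, u i x - b i = l * (w x - w g0) := by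
    intro i hi
    have hk : LinearMap.ker (w : (Fin d → ℝ) →ₗ[ℝ] ℝ) ≤ LinearMap.ker (u i) :=
      hker ▸ hspan (u i) (b i) hi
    have hq : w p - w g0 ≠ 0 := by linarith
    have hform : ∀ x, u i x - b i = (u i p - b i) / (w p - w g0) * (w x - w g0) := by
      intro x
      have hmem : (x - g0) - ((w x - w g0) / (w p - w g0)) • (p - g0) ∈
          LinearMap.ker (w : (Fin d → ℝ) →ₗ[ℝ] ℝ) := by
        simp only [LinearMap.mem_ker, ContinuousLinearMap.coe_coe, map_sub, map_smul, smul_eq_mul]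
        field_simp
        ring
      have := hk hmem
      simp only [LinearMap.mem_ker, map_sub, map_smul, smul_eq_mul, hi g0 hg0] at this
      rw [sub_eq_zero.1 this]
      ring
    refine ⟨_, ?_, hform⟩
    apply div_nonneg_of_nonpos
    · linarith [(hPm p).1 hpP i]
    · linarith
  let e : Fin m → ℝ := fun i => if ∀ y ∈ G, u i y = b i then 0 else 1
  have he1 : ∀ i, e i = 1 → ∃ g ∈ G, u i g < b i := by
    intro i hi
    by_contra hcon
    push Not at hcon
    have : e i = 0 := if_pos fun y hy => le_antisymm ((hPm y).1 (hGP y hy) i) (hcon y hy)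
    linarith
  have he0 : ∀ i, e i ≠ 1 → ∀ y ∈ G, u i y = b i := by
    intro i hi
    by_contra hcon
    exact hi (if_neg hcon)
  have hcont : ∀ i, Continuous (u i) := fun i => (u i).continuous_of_finiteDimensional
  have hopen : IsOpen {y | ∀ i, e i = 1 → u i y < b i} := by
    simp only [Set.ofPred_forall]
    exact isOpen_iInter_of_finite fun i => isOpen_iInter_of_finite fun _ =>
      isOpen_lt (hcont i) continuous_const
  have hsub : ∀ y, (∀ i, e i = 1 → u i y < b i) → w y ≤ w g0 → y ∈ P := by
    intro y hy hwy
    refine (hPm y).2 fun i => ?_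
    by_cases hi : e i = 1
    · exact (hy i hi).le
    · obtain ⟨l, hl, hlf⟩ := htight i (he0 i hi)
      have := hlf y
      nlinarith
  obtain ⟨ν, μ, ρ, hν, hμ, hρ, hx0, h1, h2⟩ := motzkin_aux u b e
    (fun i => (em (∀ y ∈ G, u i y = b i)).imp (fun h => if_pos h) (fun h => if_neg h)) v c (by
    intro x hxP hxs hxQ
    have hxP' := (hPm x).2 hxP
    have hxQ' := (hQm x).2 hxQ
    rcases lt_or_eq_of_le (hwle x hxP') with hlt | heq
    · have : x ∈ interior P := by
        refine mem_interior.2 ⟨{y | ∀ i, e i = 1 → u i y < b i} ∩ {y | w y < w g0}, ?_, ?_, hxs, hlt⟩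
        · rintro y ⟨hy, hy2⟩
          exact hsub y hy (le_of_lt hy2)
        · exact hopen.inter (isOpen_lt w.continuous continuous_const)
      exact Set.notMem_empty x (hdisj ▸ ⟨this, hxQ'⟩)
    · have hxG := hGmem x hxP' heq
      have : x ∈ intrinsicInterior ℝ G := by
        refine mem_intrinsicInterior.2 ⟨⟨x, subset_affineSpan ℝ G hxG⟩, ?_, rfl⟩
        refine mem_interior.2 ⟨(Subtype.val : affineSpan ℝ G → (Fin d → ℝ)) ⁻¹' {y | ∀ i, e i = 1 → u i y < b i}, ?_,
          hopen.preimage continuous_subtype_val, hxs⟩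
        rintro ⟨y, hyA⟩ hy
        have hd : y - g0 ∈ (affineSpan ℝ G).direction :=
          AffineSubspace.vsub_mem_direction hyA (subset_affineSpan ℝ G hg0)
        have hwy : w y = w g0 := by
          have := hspan w (w g0) hwG hd
          simp only [LinearMap.mem_ker, ContinuousLinearMap.coe_coe, map_sub] at this
          linarith
        exact hGmem y (hsub y hy hwy.le) hwy
      exact Set.notMem_empty x (hGQ ▸ ⟨this, hxQ'⟩))
  let U : (Fin d → ℝ) →ₗ[ℝ] ℝ := ∑ i, ν i • u i
  have hU : ∀ x, U x = ∑ i, ν i * u i x := fun x => by simp [U]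
  have hUP : ∀ x ∈ P, U x ≤ ∑ i, ν i * b i := fun x hx => by
    rw [hU]
    exact Finset.sum_le_sum fun i _ => mul_le_mul_of_nonneg_left ((hPm x).1 hx i) (hν i)
  have hUQ : ∀ x ∈ Q, -∑ j, μ j * c j ≤ U x := fun x hx => by
    rw [hU]
    have : ∑ j, μ j * v j x ≤ ∑ j, μ j * c j :=
      Finset.sum_le_sum fun j _ => mul_le_mul_of_nonneg_left ((hQm x).1 hx j) (hμ j)
    linarith [hx0 x]
  have hUG : ∀ x ∈ intrinsicInterior ℝ G, U x < -∑ j, μ j * c j := by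
    intro x hx
    have hxG := intrinsicInterior_subset hx
    have hxP := hGP x hxG
    rcases hρ.lt_or_eq with hpos | hz
    · linarith [hUP x hxP]
    · obtain ⟨i, hi⟩ : ∃ i, 0 < ν i * e i := by
        by_contra hcon
        push Not at hcon
        have := Finset.sum_nonpos fun i (_ : i ∈ Finset.univ) => hcon i
        linarith
      have hei : e i = 1 := by
        by_contra hne
        have : e i = 0 := if_pos (he0 i hne)
        rw [this, mul_zero] at hi
        exact lt_irrefl _ hi
      have hνi : 0 < ν i := by rw [hei, mul_one] at hi; exact hi
      obtain ⟨g, hg, hgl⟩ := he1 i hei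
      have hs := relint_strict (u i) (b i) (fun y hy => (hPm y).1 (hGP y hy) i) hg hgl hx
      have : U x < ∑ i, ν i * b i := by
        rw [hU]
        exact Finset.sum_lt_sum
          (fun i _ => mul_le_mul_of_nonneg_left ((hPm x).1 hxP i) (hν i))
          ⟨i, Finset.mem_univ i, mul_lt_mul_of_pos_left hs hνi⟩
      linarith
  refine ⟨U, -∑ j, μ j * c j, ?_, ?_, hUG, ?_⟩
  · intro hU0
    have hconv : Convex ℝ G := by
      intro x hx y hy s t hs ht hst
      have hxP := (hPm x).1 (hGP x hx)
      have hyP := (hPm y).1 (hGP y hy)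
      refine hGmem _ ((hPm _).2 fun i => ?_) ?_
      · simp only [map_add, map_smul, smul_eq_mul]
        have e1 := mul_le_mul_of_nonneg_left (hxP i) hs
        have e2 := mul_le_mul_of_nonneg_left (hyP i) ht
        have e3 : s * b i + t * b i = b i := by rw [← add_mul, hst, one_mul]
        linarith
      · simp only [map_add, map_smul, smul_eq_mul, hwG x hx, hwG y hy]
        rw [← add_mul, hst, one_mul]
    obtain ⟨x, hx⟩ := Set.Nonempty.intrinsicInterior hconv ⟨g0, hg0⟩
    obtain ⟨q, hq⟩ := hQne
    have a1 := hUG x hx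
    have a2 := hUQ q hq
    rw [hU0] at a1 a2
    simp only [LinearMap.zero_apply] at a1 a2
    linarith
  · intro x hx
    have := hUP x hx
    show U x ≤ _
    linarith
  · ext x
    simp only [Set.mem_inter_iff, Set.mem_ofPred_eq, Set.mem_empty_iff_false, iff_false, not_and,
      not_lt]
    exact hUQ x
end

section
/- Let Λ ⊆ ℝ^d be a lattice of rank r and let C, D ⊆ ℝ^d be nonempty convex sets with C a polytope and D a polytope. Set S = (C + Λ) ∩ D. Then every d-dimensional maximal S-free set is a polyhedron with at most 2^r facets. -/
section aux
open Set Filter Topology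
lemma ext_finite {n : Type*} [Fintype n] {W : Type*} [AddCommGroup W] [Module ℝ W]
    (A : (n → ℝ) →ₗ[ℝ] W) (w : W) :
    (({x : n → ℝ | (∀ i, 0 ≤ x i) ∧ A x = w} : Set (n → ℝ)).extremePoints ℝ).Finite := by
  refine Set.Finite.of_injOn (f := fun x : n → ℝ => {i | x i ≠ 0}) (t := Set.univ)
    (fun _ _ => Set.mem_univ _) ?_ Set.finite_univ
  intro x hx y hy hxy
  have hs : ∀ i, x i = 0 → y i = 0 := by
    intro i hi
    by_contra h
    have : i ∈ {i | x i ≠ 0} := by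
      have h2 : i ∈ {i | y i ≠ 0} := h
      have h3 : {i | x i ≠ 0} = {i | y i ≠ 0} := hxy
      rw [h3]; exact h2
    exact this hi
  have key : ∀ᶠ ε in 𝓝[>] (0:ℝ), ∀ i, 0 < x i + ε * (y i - x i) ∧ 0 < x i - ε * (y i - x i) ∨ x i = 0 := by
    rw [Filter.eventually_all]
    intro i
    by_cases hi : x i = 0
    · exact Filter.Eventually.of_forall fun _ => Or.inr hi
    · have hpos : 0 < x i := lt_of_le_of_ne (hx.1.1 i) (Ne.symm hi)
      have c1 : Tendsto (fun ε : ℝ => x i + ε * (y i - x i)) (𝓝[>] 0) (𝓝 (x i + 0 * (y i - x i))) :=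
        (Continuous.tendsto (by fun_prop) 0).mono_left nhdsWithin_le_nhds
      have c2 : Tendsto (fun ε : ℝ => x i - ε * (y i - x i)) (𝓝[>] 0) (𝓝 (x i - 0 * (y i - x i))) :=
        (Continuous.tendsto (by fun_prop) 0).mono_left nhdsWithin_le_nhds
      filter_upwards [c1.eventually_const_lt (u := 0) (by simpa using hpos),
        c2.eventually_const_lt (u := 0) (by simpa using hpos)] with ε h1 h2
      exact Or.inl ⟨h1, h2⟩
  obtain ⟨ε, hε, hε0⟩ := (key.and self_mem_nhdsWithin).exists
  have hε0 : 0 < ε := hε0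
  have m1 : x + ε • (y - x) ∈ {x : n → ℝ | (∀ i, 0 ≤ x i) ∧ A x = w} := by
    refine ⟨fun i => ?_, ?_⟩
    · rcases hε i with h | h
      · simpa using h.1.le
      · simp [h, hs i h]
    · simp [map_add, map_smul, map_sub, hx.1.2, hy.1.2]
  have m2 : x - ε • (y - x) ∈ {x : n → ℝ | (∀ i, 0 ≤ x i) ∧ A x = w} := by
    refine ⟨fun i => ?_, ?_⟩
    · rcases hε i with h | h
      · simpa using h.2.le
      · simp [h, hs i h]
    · simp [map_smul, map_sub, hx.1.2, hy.1.2]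
  have := (mem_extremePoints.1 hx).2 _ m1 _ m2 ⟨1/2, 1/2, by norm_num, by norm_num, by norm_num, by
    module⟩
  have h3 : ε • (y - x) = 0 := by simpa using this.1
  rcases smul_eq_zero.1 h3 with h | h
  · exact absurd h hε0.ne'
  · exact (sub_eq_zero.1 h).symm

lemma inter_polytope {E : Type*} [AddCommGroup E] [Module ℝ E] [TopologicalSpace E]
    [IsTopologicalAddGroup E] [ContinuousSMul ℝ E] [T2Space E] (V W : Finset E) :
    ∃ U : Finset E, convexHull ℝ (V : Set E) ∩ convexHull ℝ (W : Set E) = convexHull ℝ (U : Set E) := by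
  classical
  let BV : ((V ⊕ W) → ℝ) →ₗ[ℝ] E := ∑ v : V, (LinearMap.proj (R := ℝ) (φ := fun _ : V ⊕ W => ℝ) (Sum.inl v)).smulRight (v : E)
  let BW : ((V ⊕ W) → ℝ) →ₗ[ℝ] E := ∑ v : W, (LinearMap.proj (R := ℝ) (φ := fun _ : V ⊕ W => ℝ) (Sum.inr v)).smulRight (v : E)
  let sV : ((V ⊕ W) → ℝ) →ₗ[ℝ] ℝ := ∑ v : V, (LinearMap.proj (R := ℝ) (φ := fun _ : V ⊕ W => ℝ) (Sum.inl v))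
  let sW : ((V ⊕ W) → ℝ) →ₗ[ℝ] ℝ := ∑ v : W, (LinearMap.proj (R := ℝ) (φ := fun _ : V ⊕ W => ℝ) (Sum.inr v))
  have eBV : ∀ x, BV x = ∑ v : V, x (Sum.inl v) • (v : E) := fun x => by simp [BV]
  have eBW : ∀ x, BW x = ∑ v : W, x (Sum.inr v) • (v : E) := fun x => by simp [BW]
  have esV : ∀ x, sV x = ∑ v : V, x (Sum.inl v) := fun x => by simp [sV]
  have esW : ∀ x, sW x = ∑ v : W, x (Sum.inr v) := fun x => by simp [sW]
  let A := sV.prod (sW.prod (BV - BW))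
  set T : Set ((V ⊕ W) → ℝ) := {x | (∀ i, 0 ≤ x i) ∧ A x = (1, 1, 0)} with hT
  have hTm : ∀ x, x ∈ T ↔ (∀ i, 0 ≤ x i) ∧ sV x = 1 ∧ sW x = 1 ∧ BV x = BW x := by
    intro x
    simp [hT, A, Prod.ext_iff, sub_eq_zero]
  have hfin := ext_finite A (1, 1, 0)
  rw [← hT] at hfin
  have hcl : IsClosed T := by
    have c1 : Continuous BV := LinearMap.continuous_of_finiteDimensional _
    have c2 : Continuous BW := LinearMap.continuous_of_finiteDimensional _
    have c3 : Continuous sV := LinearMap.continuous_of_finiteDimensional _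
    have c4 : Continuous sW := LinearMap.continuous_of_finiteDimensional _
    have : T = (⋂ i, {x : (V ⊕ W) → ℝ | 0 ≤ x i}) ∩ ({x | sV x = 1} ∩ ({x | sW x = 1} ∩ {x | BV x = BW x})) := by
      ext x; rw [hTm]; simp
    rw [this]
    exact (isClosed_iInter fun i => isClosed_le continuous_const (continuous_apply i)).inter
      ((isClosed_eq c3 continuous_const).inter ((isClosed_eq c4 continuous_const).inter (isClosed_eq c1 c2)))
  have hcomp : IsCompact T := by
    refine (isCompact_Icc (a := (0 : (V ⊕ W) → ℝ)) (b := 1)).of_isClosed_subset hcl ?_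
    intro x hx
    rw [hTm] at hx
    obtain ⟨h0, h1, h2, -⟩ := hx
    refine ⟨h0, ?_⟩
    rintro (i | i)
    · rw [esV] at h1
      rw [Pi.one_apply, ← h1]
      exact Finset.single_le_sum (f := fun v : V => x (Sum.inl v)) (fun v _ => h0 _) (Finset.mem_univ i)
    · rw [esW] at h2
      rw [Pi.one_apply, ← h2]
      exact Finset.single_le_sum (f := fun v : W => x (Sum.inr v)) (fun v _ => h0 _) (Finset.mem_univ i)
  have hconv : Convex ℝ T := by
    intro x hx y hy a b ha hb hab
    refine ⟨fun i => ?_, ?_⟩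
    · have := mul_nonneg ha (hx.1 i)
      have := mul_nonneg hb (hy.1 i)
      simp; linarith
    · rw [map_add, map_smul, map_smul, hx.2, hy.2, ← add_smul, hab, one_smul]
  have hKM := closure_convexHull_extremePoints hcomp hconv
  rw [(hfin.isClosed_convexHull ℝ).closure_eq] at hKM
  have himg : convexHull ℝ (V : Set E) ∩ convexHull ℝ (W : Set E) = BV '' T := by
    ext x
    constructor
    · rintro ⟨h1, h2⟩
      rw [Finset.mem_convexHull'] at h1 h2
      obtain ⟨a, ha0, ha1, hax⟩ := h1
      obtain ⟨b, hb0, hb1, hbx⟩ := h2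
      have e1 : BV (Sum.elim (fun v : V => a v) (fun v : W => b v)) = x := by
        rw [eBV, ← hax]; simpa using Finset.sum_coe_sort V (fun v => a v • v)
      refine ⟨Sum.elim (fun v : V => a v) (fun v : W => b v), (hTm _).2 ⟨?_, ?_, ?_, ?_⟩, e1⟩
      · rintro (i | i)
        · exact ha0 _ i.2
        · exact hb0 _ i.2
      · rw [esV, ← ha1]; simpa using Finset.sum_coe_sort V (fun v => a v)
      · rw [esW, ← hb1]; simpa using Finset.sum_coe_sort W (fun v => b v)
      · rw [e1, eBW, ← hbx]; symm; simpa using Finset.sum_coe_sort W (fun v => b v • v)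
    · rintro ⟨y, hy, rfl⟩
      rw [hTm] at hy
      obtain ⟨h0, h1, h2, h3⟩ := hy
      constructor
      · rw [eBV]
        exact (convex_convexHull ℝ _).sum_mem (fun i _ => h0 _) (by rw [← esV, h1]) (fun i _ => subset_convexHull _ _ i.2)
      · rw [h3, eBW]
        exact (convex_convexHull ℝ _).sum_mem (fun i _ => h0 _) (by rw [← esW, h2]) (fun i _ => subset_convexHull _ _ i.2)
  refine ⟨(hfin.image BV).toFinset, ?_⟩
  rw [himg, Set.Finite.coe_toFinset, ← LinearMap.image_convexHull, hKM]

/-- enlarge a bit beyond an interior point -/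
lemma exists_beyond {E : Type*} [NormedAddCommGroup E] [NormedSpace ℝ E] {L : Set E} {x : E} (hx : x ∈ interior L) (y : E) :
    ∃ ε : ℝ, 0 < ε ∧ x + ε • (x - y) ∈ L := by
  have c : Tendsto (fun ε : ℝ => x + ε • (x - y)) (𝓝[>] 0) (𝓝 (x + (0:ℝ) • (x - y))) :=
    (Continuous.tendsto (by fun_prop) 0).mono_left nhdsWithin_le_nhds
  have h := c.eventually (p := fun z => z ∈ L) (by
    rw [zero_smul, add_zero]; exact mem_interior_iff_mem_nhds.1 hx)
  obtain ⟨ε, h1, h2⟩ := (h.and self_mem_nhdsWithin).exists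
  exact ⟨ε, h2, h1⟩

lemma lt_of_interior {E : Type*} [NormedAddCommGroup E] [NormedSpace ℝ E] {L : Set E} (f : E →L[ℝ] ℝ) (c : ℝ)
    (hf : ∀ x ∈ L, f x ≤ c) {y : E} (hy : f y < c) {x : E} (hx : x ∈ interior L) : f x < c := by
  obtain ⟨ε, h0, h1⟩ := exists_beyond hx y
  have h2 := hf _ h1
  have h3 := hf _ (interior_subset hx)
  rcases h3.lt_or_eq with h | h
  · exact h
  · exfalso
    simp only [map_add, map_smul, map_sub, smul_eq_mul] at h2
    nlinarith [mul_pos h0 (sub_pos.2 hy)]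

lemma le_of_interior {E : Type*} [NormedAddCommGroup E] [NormedSpace ℝ E] {L : Set E} (hL : Convex ℝ L)
    (hne : (interior L).Nonempty) (f : E →L[ℝ] ℝ) (c : ℝ)
    (hf : ∀ x ∈ interior L, f x < c) : ∀ x ∈ L, f x ≤ c := by
  intro x hx
  have h : x ∈ closure (interior L) := by
    rw [hL.closure_interior_eq_closure_of_nonempty_interior hne]; exact subset_closure hx
  exact closure_minimal (t := {x | f x ≤ c}) (fun y hy => (hf y hy).le)
    (isClosed_le f.continuous continuous_const) h

/-- separators -/
def IsSep {E : Type*} [NormedAddCommGroup E] [NormedSpace ℝ E] (L P : Set E) (z : E) (f : E →L[ℝ] ℝ) (c : ℝ) : Prop :=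
  (∀ x ∈ L, f x ≤ c) ∧ (∀ x ∈ P, c ≤ f x) ∧ f z < c

lemma exists_sep {E : Type*} [NormedAddCommGroup E] [NormedSpace ℝ E] {L P : Set E} (hL : Convex ℝ L) (hP : Convex ℝ P)
    {z : E} (hz : z ∈ interior L) (h : Disjoint (interior L) P) : ∃ f c, IsSep L P z f c := by
  obtain ⟨f, c, h1, h2⟩ := geometric_hahn_banach_open hL.interior isOpen_interior hP h
  exact ⟨f, c, le_of_interior hL ⟨z, hz⟩ f c h1, h2, h1 z hz⟩

lemma sep_free {E : Type*} [NormedAddCommGroup E] [NormedSpace ℝ E] {ι : Type*} {L : Set E} {P : ι → Set E} {z : E}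
    (f : ι → E →L[ℝ] ℝ) (c : ι → ℝ) (h : ∀ j, IsSep L (P j) z (f j) (c j)) :
    IsClosed {x | ∀ j, f j x ≤ c j} ∧ Convex ℝ {x | ∀ j, f j x ≤ c j} ∧
    interior {x | ∀ j, f j x ≤ c j} ∩ (⋃ j, P j) = ∅ ∧ L ⊆ {x | ∀ j, f j x ≤ c j} := by
  refine ⟨?_, ?_, ?_, fun x hx j => (h j).1 x hx⟩
  · simp only [ofPred_forall]
    exact isClosed_iInter fun j => isClosed_le (f j).continuous continuous_const
  · simp only [ofPred_forall]
    exact convex_iInter fun j => convex_halfSpace_le (f j).toLinearMap.isLinear _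
  · rw [eq_empty_iff_forall_notMem]
    rintro x ⟨hx, hx2⟩
    obtain ⟨j, hj⟩ := mem_iUnion.1 hx2
    have := lt_of_interior (f j) (c j) (fun y (hy : y ∈ {x | ∀ j, f j x ≤ c j}) => hy j) (h j).2.2 hx
    exact absurd ((h j).2.1 x hj) (not_le.2 this)

lemma big_M {E : Type*} [NormedAddCommGroup E] [NormedSpace ℝ E] (V : Finset E) (a w : E →L[ℝ] ℝ) (b c : ℝ)
    (ha : ∀ x ∈ convexHull ℝ (V : Set E), b ≤ a x)
    (hw : ∀ x ∈ convexHull ℝ (V : Set E), a x = b → c ≤ w x) :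
    ∃ M : ℝ, 0 ≤ M ∧ ∀ x ∈ convexHull ℝ (V : Set E), c + M * b ≤ w x + M * a x := by
  have key : ∀ᶠ M : ℝ in atTop, ∀ x ∈ V, c + M * b ≤ w x + M * a x := by
    rw [Filter.eventually_all_finset]
    intro x hx
    have hx' : x ∈ convexHull ℝ (V : Set E) := subset_convexHull _ _ hx
    rcases (ha x hx').lt_or_eq with h | h
    · filter_upwards [eventually_ge_atTop ((c - w x) / (a x - b))] with M hM
      rw [div_le_iff₀ (by linarith)] at hM
      nlinarith
    · filter_upwards with M
      have := hw x hx' h.symm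
      rw [h]; linarith
  obtain ⟨M, h1, h2⟩ := (key.and (eventually_ge_atTop 0)).exists
  refine ⟨M, h2, fun x hx => ?_⟩
  have : convexHull ℝ (V : Set E) ⊆ {x | c + M * b ≤ (w + M • a) x} :=
    convexHull_min (fun y hy => by simpa using h1 y hy) (convex_halfSpace_ge (w + M • a).toLinearMap.isLinear _)
  simpa using this hx

lemma orthant_sep {E : Type*} [NormedAddCommGroup E] [NormedSpace ℝ E] {K : Type*} [Fintype K] (G : Set E) (hG : Convex ℝ G)
    (hne : G.Nonempty) (f : K → E →L[ℝ] ℝ) (c : K → ℝ) (h : ∀ g ∈ G, ¬ ∀ k, f k g < c k) :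
    ∃ l : K → ℝ, (∀ k, 0 ≤ l k) ∧ (∃ k, 0 < l k) ∧ ∀ g ∈ G, ∑ k, l k * c k ≤ ∑ k, l k * f k g := by
  classical
  let O : Set (K → ℝ) := {y | ∀ k, 0 < y k}
  have hOo : IsOpen O := by
    simp only [O, ofPred_forall]
    exact isOpen_iInter_of_finite fun k => isOpen_lt continuous_const (continuous_apply k)
  have hOc : Convex ℝ O := by
    intro x hx y hy a b ha hb hab k
    have h1 := hx k
    have h2 := hy k
    simp only [Pi.add_apply, Pi.smul_apply, smul_eq_mul]
    rcases ha.lt_or_eq with h | h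
    · nlinarith [mul_pos h h1, mul_nonneg hb h2.le]
    · subst h; have : b = 1 := by linarith
      subst this; linarith
  let Φ : E → (K → ℝ) := fun x k => c k - f k x
  have hI : Convex ℝ (Φ '' G) := by
    rintro _ ⟨x, hx, rfl⟩ _ ⟨y, hy, rfl⟩ a b ha hb hab
    refine ⟨a • x + b • y, hG hx hy ha hb hab, ?_⟩
    ext k
    simp only [Φ, Pi.add_apply, Pi.smul_apply, smul_eq_mul, map_add, map_smul]
    linear_combination (-c k) * hab
  have hd : Disjoint O (Φ '' G) := by
    rw [Set.disjoint_left]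
    rintro _ hy ⟨x, hx, rfl⟩
    exact h x hx fun k => by have := hy k; simp only [Φ] at this; linarith
  obtain ⟨φ, u, h1, h2⟩ := geometric_hahn_banach_open hOc hOo hI hd
  have hφ : ∀ y, φ y = ∑ k, y k * φ (Pi.single k 1) := by
    intro y
    conv_lhs => rw [← Finset.univ_sum_single y]
    rw [map_sum]
    refine Finset.sum_congr rfl fun k _ => ?_
    have : Pi.single k (y k) = y k • (Pi.single k 1 : K → ℝ) := by
      rw [← Pi.single_smul, smul_eq_mul, mul_one]
    rw [this, map_smul, smul_eq_mul]
  have hcl : ∀ y : K → ℝ, (∀ k, 0 ≤ y k) → φ y ≤ u := by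
    intro y hy
    have c1 : Tendsto (fun ε : ℝ => φ (y + ε • (fun _ => 1))) (𝓝[>] 0) (𝓝 (φ (y + (0:ℝ) • (fun _ => 1)))) :=
      (Continuous.tendsto (by fun_prop) 0).mono_left nhdsWithin_le_nhds
    rw [zero_smul, add_zero] at c1
    refine le_of_tendsto c1 ?_
    filter_upwards [self_mem_nhdsWithin] with ε hε
    refine (h1 _ fun k => ?_).le
    have h3 : 0 < ε := hε
    have := hy k
    simp; linarith
  have hu : 0 ≤ u := by simpa using hcl 0 (fun _ => le_rfl)
  have hneg : ∀ k, φ (Pi.single k 1) ≤ 0 := by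
    intro k
    by_contra hk
    push Not at hk
    have := hcl (((u + 1) / φ (Pi.single k 1)) • Pi.single k 1) (fun i => by
      have : (0:ℝ) ≤ (Pi.single k 1 : K → ℝ) i := by
        by_cases hik : i = k
        · subst hik; simp
        · simp [hik]
      simp only [Pi.smul_apply, smul_eq_mul]
      positivity)
    rw [map_smul, smul_eq_mul, div_mul_cancel₀ _ hk.ne'] at this
    linarith
  refine ⟨fun k => - φ (Pi.single k 1), fun k => by linarith [hneg k], ?_, ?_⟩
  · by_contra hcon
    push Not at hcon
    have hz : ∀ y, φ y = 0 := by
      intro y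
      rw [hφ]
      refine Finset.sum_eq_zero fun k _ => ?_
      have : φ (Pi.single k 1) = 0 := le_antisymm (hneg k) (by linarith [hcon k])
      rw [this, mul_zero]
    obtain ⟨g, hg⟩ := hne
    have a1 := h1 (fun _ => 1) (fun _ => one_pos)
    have a2 := h2 _ ⟨g, hg, rfl⟩
    rw [hz] at a1 a2
    linarith
  · intro g hg
    have a2 := h2 _ ⟨g, hg, rfl⟩
    rw [hφ] at a2
    have : ∑ k, (Φ g k) * φ (Pi.single k 1) = ∑ k, (- φ (Pi.single k 1)) * f k g - ∑ k, (- φ (Pi.single k 1)) * c k := by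
      rw [← Finset.sum_sub_distrib]
      refine Finset.sum_congr rfl fun k _ => ?_
      simp only [Φ]; ring
    linarith

def RelF {d : ℕ} (L F : Set (Fin d → ℝ)) (s : Fin d → ℝ) : Prop :=
  s ∈ F ∧ ∀ (f : (Fin d → ℝ) →L[ℝ] ℝ) (c : ℝ), (∀ x ∈ L, f x ≤ c) → f s = c → ∀ x ∈ F, f x = c

lemma eq_smul_of_ker {E : Type*} [NormedAddCommGroup E] [NormedSpace ℝ E] (f l : E →L[ℝ] ℝ)
    (h : ∀ x, l x = 0 → f x = 0) : ∃ t : ℝ, ∀ x, f x = t * l x := by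
  by_cases hl : ∀ x, l x = 0
  · exact ⟨0, fun x => by rw [h x (hl x), zero_mul]⟩
  · push Not at hl
    obtain ⟨u, hu⟩ := hl
    refine ⟨f u / l u, fun x => ?_⟩
    have := h (x - (l x / l u) • u) (by simp [div_mul_cancel₀ _ hu])
    simp only [map_sub, map_smul, smul_eq_mul] at this
    field_simp
    field_simp at this
    linarith

lemma facet_data {d : ℕ} {L F : Set (Fin d → ℝ)} {z : Fin d → ℝ} (hL : Convex ℝ L)
    (hz : z ∈ interior L) (hF : IsFacet L F) :
    ∃ (l : (Fin d → ℝ) →L[ℝ] ℝ) (β : ℝ), (∀ x ∈ L, l x ≤ β) ∧ (∀ x, x ∈ F ↔ x ∈ L ∧ l x = β) ∧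
      l z < β ∧ (∀ (f : (Fin d → ℝ) →L[ℝ] ℝ) (c : ℝ), (∀ x ∈ F, f x = c) →
        ∃ t : ℝ, (∀ x, f x = t * l x) ∧ c = t * β) ∧ ∃ q, RelF L F q := by
  obtain ⟨⟨x0, hx0⟩, hexp, hdim⟩ := hF
  obtain ⟨l, hl⟩ := hexp ⟨x0, hx0⟩
  have hx0' := hx0
  rw [hl] at hx0'
  have hβ : ∀ x ∈ L, l x ≤ l x0 := hx0'.2
  have hFm : ∀ x, x ∈ F ↔ x ∈ L ∧ l x = l x0 := by
    intro x
    constructor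
    · intro hx
      rw [hl] at hx
      exact ⟨hx.1, le_antisymm (hβ x hx.1) (hx.2 x0 hx0'.1)⟩
    · rintro ⟨h1, h2⟩
      rw [hl]
      exact ⟨h1, fun y hy => h2 ▸ hβ y hy⟩
  have hFL : F ⊆ L := fun x hx => ((hFm x).1 hx).1
  have hFc : Convex ℝ F := by
    have : F = L ∩ {x | l x = l x0} := by ext x; exact hFm x
    rw [this]
    exact hL.inter (convex_hyperplane l.toLinearMap.isLinear _)
  have hlz : l z < l x0 := by
    by_contra hcon
    have hall : ∀ y ∈ L, l y = l x0 := by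
      intro y hy
      by_contra hy2
      exact hcon (lt_of_interior l _ hβ (lt_of_le_of_ne (hβ y hy) hy2) hz)
    have hFeq : F = L := subset_antisymm hFL fun x hx => (hFm x).2 ⟨hx, hall x hx⟩
    have htop : affineSpan ℝ L = ⊤ := (hL.interior_nonempty_iff_affineSpan_eq_top).1 ⟨z, hz⟩
    rw [hFeq, adim, htop, AffineSubspace.direction_top, finrank_top] at hdim
    simp at hdim
  have hker : ∀ f : (Fin d → ℝ) →L[ℝ] ℝ, ∀ c : ℝ, (∀ x ∈ F, f x = c) →
      (affineSpan ℝ F).direction ≤ LinearMap.ker f.toLinearMap := by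
    intro f c hf
    rw [direction_affineSpan, vectorSpan_def, Submodule.span_le]
    rintro _ ⟨a, ha, b, hb, rfl⟩
    simp [hf a ha, hf b hb]
  have hleq : (affineSpan ℝ F).direction = LinearMap.ker l.toLinearMap := by
    refine Submodule.eq_of_le_of_finrank_eq (hker l (l x0) fun x hx => ((hFm x).1 hx).2) ?_
    have h1 := LinearMap.finrank_range_add_finrank_ker l.toLinearMap
    have h2 : LinearMap.range l.toLinearMap = ⊤ := by
      refine LinearMap.range_eq_top.2 (LinearMap.surjective ?_)
      intro h0
      have h3 : ∀ x, l x = 0 := fun x => by simpa using LinearMap.congr_fun h0 x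
      rw [h3, h3] at hlz
      exact lt_irrefl _ hlz
    rw [h2, finrank_top] at h1
    simp only [Module.finrank_self, Module.finrank_fintype_fun_eq_card, Fintype.card_fin] at h1
    unfold adim at hdim
    omega
  refine ⟨l, l x0, hβ, hFm, hlz, ?_, ?_⟩
  · intro f c hf
    have h1 := hker f c hf
    rw [hleq] at h1
    obtain ⟨t, ht⟩ := eq_smul_of_ker f l (fun x hx => by
      have : x ∈ LinearMap.ker f.toLinearMap := h1 (by simpa using hx)
      simpa using this)
    exact ⟨t, ht, by rw [← ht, hf x0 hx0]⟩
  · obtain ⟨t, htF, htspan, hti⟩ := exists_affineIndependent ℝ (Fin d → ℝ) F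
    have hfin : t.Finite := finite_set_of_fin_dim_affineIndependent ℝ hti
    let T := hfin.toFinset
    have hTne : T.Nonempty := by
      rw [Set.Finite.toFinset_nonempty]
      rw [← affineSpan_nonempty (k := ℝ), htspan, affineSpan_nonempty]
      exact ⟨x0, hx0⟩
    have hcard : (0:ℝ) < T.card := by exact_mod_cast hTne.card_pos
    refine ⟨∑ y ∈ T, (T.card : ℝ)⁻¹ • y, ?_, ?_⟩
    · refine hFc.sum_mem (fun i _ => by positivity) ?_ (fun i hi => htF (hfin.mem_toFinset.1 hi))
      rw [Finset.sum_const, nsmul_eq_mul, mul_inv_cancel₀ hcard.ne']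
    · intro f c hf hq
      have hT : ∀ y ∈ T, f y = c := by
        rw [map_sum] at hq
        simp only [map_smul, smul_eq_mul] at hq
        rw [← Finset.mul_sum] at hq
        have hs : ∑ y ∈ T, f y = ∑ y ∈ T, c := by
          rw [Finset.sum_const, nsmul_eq_mul, ← hq, ← mul_assoc, mul_inv_cancel₀ hcard.ne', one_mul]
        exact (Finset.sum_eq_sum_iff_of_le (fun y hy => hf y (hFL (htF (hfin.mem_toFinset.1 hy))))).1 hs
      obtain ⟨y0, hy0⟩ := hTne
      have hy0F : y0 ∈ F := htF (hfin.mem_toFinset.1 hy0)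
      intro x hx
      have h1 : (affineSpan ℝ t).direction ≤ LinearMap.ker f.toLinearMap := by
        rw [direction_affineSpan, vectorSpan_def, Submodule.span_le]
        rintro _ ⟨a, ha, b, hb, rfl⟩
        simp [hT a (hfin.mem_toFinset.2 ha), hT b (hfin.mem_toFinset.2 hb)]
      rw [htspan] at h1
      have h2 : x - y0 ∈ LinearMap.ker f.toLinearMap :=
        h1 (AffineSubspace.vsub_mem_direction (subset_affineSpan ℝ F hx) (subset_affineSpan ℝ F hy0F))
      have h3 : f x - f y0 = 0 := by simpa using h2
      rw [hT y0 hy0] at h3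
      linarith

lemma midpoint_interior {d : ℕ} {L F F' : Set (Fin d → ℝ)} {z s s' : Fin d → ℝ} (hL : Convex ℝ L)
    (hz : z ∈ interior L) (hF : IsFacet L F) (hF' : IsFacet L F') (hs : RelF L F s)
    (hs' : RelF L F' s') (hne : F ≠ F') : (1/2 : ℝ) • (s + s') ∈ interior L := by
  by_contra hm
  obtain ⟨f, hf⟩ := geometric_hahn_banach_open_point hL.interior isOpen_interior hm
  set c := f ((1/2 : ℝ) • (s + s')) with hc
  have hfz := hf z hz
  have hle := le_of_interior hL ⟨z, hz⟩ f c hf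
  have main : ∀ F s, IsFacet L F → RelF L F s → f s = c → F = {x | x ∈ L ∧ f x = c} := by
    intro F s hF hs hfs
    obtain ⟨l, β, h1, h2, h3, h4, -⟩ := facet_data hL hz hF
    have h5 := hs.2 f c hle hfs
    obtain ⟨t, ht, htc⟩ := h4 f c h5
    ext x
    constructor
    · intro hx
      exact ⟨((h2 x).1 hx).1, h5 x hx⟩
    · rintro ⟨hx, hxc⟩
      refine (h2 x).2 ⟨hx, ?_⟩
      have ht0 : t ≠ 0 := by
        rintro rfl
        rw [ht, htc] at hfz
        simp at hfz
      rw [ht, htc] at hxc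
      exact mul_left_cancel₀ ht0 hxc
  have sL : s ∈ L := by
    obtain ⟨l, β, h1, h2, -⟩ := facet_data hL hz hF
    exact ((h2 s).1 hs.1).1
  have sL' : s' ∈ L := by
    obtain ⟨l, β, h1, h2, -⟩ := facet_data hL hz hF'
    exact ((h2 s').1 hs'.1).1
  have e : c = (1/2) * (f s + f s') := by rw [hc]; simp; ring
  have a1 := hle s sL
  have a2 := hle s' sL'
  apply hne
  rw [main F s hF hs (by linarith), main F' s' hF' hs' (by linarith)]

lemma facet_point {d : ℕ} {L F : Set (Fin d → ℝ)} {z : Fin d → ℝ} (hL : Convex ℝ L)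
    (hz : z ∈ interior L) (hF : IsFacet L F) {ι : Type*} [Fintype ι] (V : ι → Finset (Fin d → ℝ))
    (hfree : ∀ j, Disjoint (interior L) (convexHull ℝ (V j : Set (Fin d → ℝ))))
    (hmax : ∀ (f : ι → (Fin d → ℝ) →L[ℝ] ℝ) (c : ι → ℝ),
      (∀ j, IsSep L (convexHull ℝ (V j : Set (Fin d → ℝ))) z (f j) (c j)) →
      {x | ∀ j, f j x ≤ c j} = L) :
    ∃ s, (∃ j, s ∈ convexHull ℝ (V j : Set (Fin d → ℝ))) ∧ RelF L F s := by
  classical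
  by_contra hcon
  push Not at hcon
  obtain ⟨l, β, hlL, hFm, hlz, hfac, q, hq⟩ := facet_data hL hz hF
  have hqL : q ∈ L := ((hFm q).1 hq.1).1
  choose f c hsep using fun j => exists_sep hL (convex_convexHull ℝ (V j : Set (Fin d → ℝ))) hz (hfree j)
  have hLeq := hmax f c hsep
  have hLm : ∀ x, x ∈ L ↔ ∀ j, f j x ≤ c j := by
    intro x; conv_lhs => rw [← hLeq]
    rfl
  -- tight functionals are positive multiples of l
  have htight : ∀ k, f k q = c k → ∃ t : ℝ, 0 < t ∧ (∀ x, f k x = t * l x) ∧ c k = t * β := by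
    intro k hk
    obtain ⟨t, ht, htc⟩ := hfac (f k) (c k) (hq.2 _ _ (hsep k).1 hk)
    refine ⟨t, ?_, ht, htc⟩
    have h1 := (hsep k).2.2
    rw [ht, htc] at h1
    by_contra h
    nlinarith
  have new : ∀ j, ∃ (g : (Fin d → ℝ) →L[ℝ] ℝ) (b : ℝ),
      (∀ x ∈ L, g x ≤ b) ∧ (∀ x ∈ convexHull ℝ (V j : Set (Fin d → ℝ)), b ≤ g x) ∧ g q < b := by
    intro j
    rcases ((hsep j).1 q hqL).lt_or_eq with hj | hj
    · exact ⟨f j, c j, (hsep j).1, (hsep j).2.1, hj⟩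
    obtain ⟨tj, htj0, htj, htjc⟩ := htight j hj
    set G := convexHull ℝ (V j : Set (Fin d → ℝ)) ∩ {x | f j x = c j} with hG
    have hw : ∃ (w : (Fin d → ℝ) →L[ℝ] ℝ) (b : ℝ), (∀ x ∈ L, w x ≤ b) ∧ (∀ x ∈ G, b ≤ w x) ∧ w q < b := by
      rcases G.eq_empty_or_nonempty with hGe | hGne
      · exact ⟨0, 1, fun x _ => by simp, fun x hx => by rw [hGe] at hx; exact hx.elim, by simp⟩
      · have hGc : Convex ℝ G :=
          (convex_convexHull ℝ _).inter (convex_hyperplane (f j).toLinearMap.isLinear _)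
        let K := {k : ι // f k q < c k}
        obtain ⟨lam, l0, ⟨k0, hk0⟩, hlam⟩ := orthant_sep (K := K) G hGc hGne (fun k => f k.1) (fun k => c k.1) (by
          intro g hg hlt
          have hgβ : l g = β := by
            have : f j g = c j := hg.2
            rw [htj, htjc] at this
            exact mul_left_cancel₀ htj0.ne' this
          have heq : ∀ k, ¬ f k q < c k → f k q = c k := fun k hk =>
            ((hsep k).1 q hqL).lt_or_eq.resolve_left hk
          have hge : ∀ k, ¬ f k q < c k → ∀ x, l x = β → f k x = c k := by
            intro k hk x hx
            obtain ⟨t, -, ht, htc⟩ := htight k (heq k hk)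
            rw [ht, htc, hx]
          have hgL : g ∈ L := by
            rw [hLm]
            intro k
            by_cases hk : f k q < c k
            · exact (hlt ⟨k, hk⟩).le
            · exact (hge k hk g hgβ).le
          refine hcon g ⟨j, hg.1⟩ ⟨(hFm g).2 ⟨hgL, hgβ⟩, ?_⟩
          intro h b hhb hgb x hx
          obtain ⟨hxL, hxβ⟩ := (hFm x).1 hx
          have key : ∀ᶠ ε in 𝓝[>] (0:ℝ), ∀ k, f k (g - ε • (x - g)) ≤ c k := by
            rw [Filter.eventually_all]
            intro k
            by_cases hk : f k q < c k
            · have c1 : Tendsto (fun ε : ℝ => f k (g - ε • (x - g))) (𝓝[>] 0) (𝓝 (f k (g - (0:ℝ) • (x - g)))) :=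
                (Continuous.tendsto (by fun_prop) 0).mono_left nhdsWithin_le_nhds
              rw [zero_smul, sub_zero] at c1
              filter_upwards [c1.eventually_lt_const (hlt ⟨k, hk⟩)] with ε hε using hε.le
            · refine Filter.Eventually.of_forall fun ε => (hge k hk _ ?_).le
              simp [hgβ, hxβ]
          obtain ⟨ε, hε, hε0⟩ := (key.and self_mem_nhdsWithin).exists
          have hε0 : 0 < ε := hε0
          have h1 := hhb _ ((hLm _).2 hε)
          simp only [map_sub, map_smul, smul_eq_mul] at h1
          refine le_antisymm (hhb x hxL) ?_
          rw [hgb] at h1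
          by_contra hlt
          push Not at hlt
          nlinarith [mul_pos hε0 (sub_pos.2 hlt)])
        have ew : ∀ x, (∑ k : K, lam k • f k.1) x = ∑ k : K, lam k * f k.1 x := fun x => by
          simp
        refine ⟨∑ k : K, lam k • f k.1, ∑ k : K, lam k * c k.1, ?_, ?_, ?_⟩
        · intro x hx
          rw [ew]
          exact Finset.sum_le_sum fun k _ => mul_le_mul_of_nonneg_left ((hsep k.1).1 x hx) (l0 k)
        · intro x hx
          rw [ew]
          exact hlam x hx
        · rw [ew]
          exact Finset.sum_lt_sum (fun k _ => mul_le_mul_of_nonneg_left k.2.le (l0 k))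
            ⟨k0, Finset.mem_univ _, mul_lt_mul_of_pos_left k0.2 hk0⟩
    obtain ⟨w, b, w1, w2, w3⟩ := hw
    obtain ⟨M, hM0, hM⟩ := big_M (V j) (f j) w (c j) b (hsep j).2.1 (fun x hx hxe => w2 x ⟨hx, hxe⟩)
    refine ⟨w + M • f j, b + M * c j, ?_, ?_, ?_⟩
    · intro x hx
      have := mul_le_mul_of_nonneg_left ((hsep j).1 x hx) hM0
      have := w1 x hx
      simp; linarith
    · intro x hx
      simpa using hM x hx
    · simp [hj]; linarith
  choose g b g1 g2 g3 using new
  have hL2 := hmax g b fun j => ⟨g1 j, g2 j, lt_of_interior (g j) (b j) (g1 j) (g3 j) hz⟩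
  have hqi : q ∈ interior L := by
    rw [mem_interior_iff_mem_nhds, ← hL2]
    have : ∀ᶠ x in 𝓝 q, ∀ j, g j x ≤ b j := by
      rw [Filter.eventually_all]
      intro j
      filter_upwards [(g j).continuous.continuousAt.eventually_lt_const (g3 j)] with x hx using hx.le
    exact this
  have := lt_of_interior l β hlL hlz hqi
  exact absurd ((hFm q).1 hq.1).2 this.ne

lemma finite_lattice {d r : ℕ} (v : Fin r → (Fin d → ℝ)) (hv : LinearIndependent ℝ v)
    (C D : Set (Fin d → ℝ)) (hC : Bornology.IsBounded C) (hD : Bornology.IsBounded D) :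
    {n : Fin r → ℤ | ∃ x ∈ C, x + ∑ i, (n i : ℝ) • v i ∈ D}.Finite := by
  obtain ⟨R, hR⟩ := hC.exists_norm_le
  obtain ⟨R', hR'⟩ := hD.exists_norm_le
  have hker : LinearMap.ker (Fintype.linearCombination ℝ v) = ⊥ := by
    rw [LinearMap.ker_eq_bot]
    exact hv.fintypeLinearCombination_injective
  obtain ⟨K, -, hK⟩ := LinearMap.exists_antilipschitzWith _ hker
  refine (Set.finite_Icc (fun _ : Fin r => -⌈(K : ℝ) * (R + R')⌉) (fun _ => ⌈(K : ℝ) * (R + R')⌉)).subset ?_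
  rintro n ⟨x, hx, hxD⟩
  have h1 := hK.le_mul_dist (fun i => (n i : ℝ)) 0
  rw [map_zero, dist_zero_right, dist_zero_right, Fintype.linearCombination_apply] at h1
  have h2 : ‖∑ i, (n i : ℝ) • v i‖ ≤ R + R' := by
    have : ∑ i, (n i : ℝ) • v i = (x + ∑ i, (n i : ℝ) • v i) - x := by abel
    rw [this]
    have := norm_sub_le (x + ∑ i, (n i : ℝ) • v i) x
    linarith [hR x hx, hR' _ hxD]
  have h3 : ∀ i, |(n i : ℝ)| ≤ ⌈(K : ℝ) * (R + R')⌉ := by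
    intro i
    have h4 := norm_le_pi_norm (fun i => (n i : ℝ)) i
    rw [Real.norm_eq_abs] at h4
    have h5 := mul_le_mul_of_nonneg_left h2 K.2
    exact (h4.trans h1).trans (h5.trans (Int.le_ceil _))
  constructor
  · intro i
    have := (abs_le.1 (h3 i)).1
    exact_mod_cast this
  · intro i
    have := (abs_le.1 (h3 i)).2
    exact_mod_cast this

end aux

open Pointwise

theorem maxfree_lattice_polytopes {d r : ℕ} (v : Fin r → (Fin d → ℝ))
    (hv : LinearIndependent ℝ v) (Λ : Set (Fin d → ℝ))
    (hΛ : Λ = {x | ∃ c : Fin r → ℤ, x = ∑ i, (c i : ℝ) • v i})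
    (C D : Set (Fin d → ℝ)) (hCne : C.Nonempty) (hDne : D.Nonempty)
    (FC FD : Finset (Fin d → ℝ))
    (hC : C = convexHull ℝ (FC : Set (Fin d → ℝ)))
    (hD : D = convexHull ℝ (FD : Set (Fin d → ℝ)))
    (S : Set (Fin d → ℝ)) (hS : S = (C + Λ) ∩ D) :
    ∀ L, IsMaxFree S L → FullDim L → IsPolyhedron L ∧ FacetsLE L (2 ^ r) := by
  classical
  rintro L ⟨⟨hLcl, hL, hLfree⟩, hLmax⟩ hfull
  obtain ⟨z, hz⟩ : (interior L).Nonempty := (hL.interior_nonempty_iff_affineSpan_eq_top).2 hfull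
  have hCc : Convex ℝ C := hC ▸ convex_convexHull ℝ _
  have hDc : Convex ℝ D := hD ▸ convex_convexHull ℝ _
  have hCb : Bornology.IsBounded C := by
    rw [hC, isBounded_convexHull]; exact FC.finite_toSet.isBounded
  have hDb : Bornology.IsBounded D := by
    rw [hD, isBounded_convexHull]; exact FD.finite_toSet.isBounded
  have hfin := finite_lattice v hv C D hCb hDb
  set Z := {n : Fin r → ℤ | ∃ x ∈ C, x + ∑ i, (n i : ℝ) • v i ∈ D} with hZ
  have : Fintype Z := hfin.fintype
  have hpoly : ∀ n : Z, ∃ U : Finset (Fin d → ℝ),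
      ∀ x, x ∈ convexHull ℝ (U : Set (Fin d → ℝ)) ↔ (x - ∑ i, (n.1 i : ℝ) • v i ∈ C ∧ x ∈ D) := by
    intro n
    obtain ⟨U, hU⟩ := inter_polytope (FC.image (fun x => (∑ i, (n.1 i : ℝ) • v i) + x)) FD
    refine ⟨U, fun x => ?_⟩
    have himg : convexHull ℝ ((FC.image (fun x => (∑ i, (n.1 i : ℝ) • v i) + x) : Finset (Fin d → ℝ)) : Set (Fin d → ℝ))
        = (∑ i, (n.1 i : ℝ) • v i) +ᵥ C := by
      rw [hC, ← convexHull_vadd, Finset.coe_image]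
      rfl
    rw [← hU, himg, ← hD]
    refine and_congr_left fun _ => ?_
    rw [Set.mem_vadd_set_iff_neg_vadd_mem, vadd_eq_add, neg_add_eq_sub]
  choose V hV using hpoly
  have hSU : S = ⋃ n : Z, convexHull ℝ (V n : Set (Fin d → ℝ)) := by
    ext x
    rw [hS, Set.mem_iUnion]
    constructor
    · rintro ⟨⟨y, hy, w, hw, rfl⟩, hxD⟩
      rw [hΛ] at hw
      obtain ⟨n, rfl⟩ := hw
      refine ⟨⟨n, y, hy, hxD⟩, (hV _ _).2 ⟨?_, hxD⟩⟩
      simpa using hy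
    · rintro ⟨n, hn⟩
      obtain ⟨h1, h2⟩ := (hV _ _).1 hn
      refine ⟨⟨_, h1, _, ?_, sub_add_cancel _ _⟩, h2⟩
      rw [hΛ]
      exact ⟨n.1, rfl⟩
  have hfree : ∀ j, Disjoint (interior L) (convexHull ℝ (V j : Set (Fin d → ℝ))) := by
    intro j
    rw [Set.disjoint_iff_inter_eq_empty, Set.eq_empty_iff_forall_notMem]
    rintro x ⟨h1, h2⟩
    have : x ∈ interior L ∩ S := ⟨h1, by rw [hSU]; exact Set.mem_iUnion.2 ⟨j, h2⟩⟩
    rw [hLfree] at this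
    exact this
  have hmax : ∀ (f : Z → (Fin d → ℝ) →L[ℝ] ℝ) (c : Z → ℝ),
      (∀ j, IsSep L (convexHull ℝ (V j : Set (Fin d → ℝ))) z (f j) (c j)) →
      {x | ∀ j, f j x ≤ c j} = L := by
    intro f c h
    obtain ⟨h1, h2, h3, h4⟩ := sep_free f c h
    exact hLmax _ ⟨h1, h2, by rw [hSU]; exact h3⟩ h4
  constructor
  · choose f c hsep using fun j => exists_sep hL (convex_convexHull ℝ (V j : Set (Fin d → ℝ))) hz (hfree j)
    let e := Fintype.equivFin Z
    refine ⟨Fintype.card Z, fun i => (f (e.symm i)).toLinearMap, fun i => c (e.symm i), ?_⟩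
    rw [← hmax f c hsep]
    ext x
    constructor
    · intro h i; exact h (e.symm i)
    · intro h j; simpa using h (e j)
  · have hpt : ∀ F : Set (Fin d → ℝ), ∃ (s y : Fin d → ℝ) (n : Fin r → ℤ), IsFacet L F →
        RelF L F s ∧ y ∈ C ∧ s = y + ∑ i, (n i : ℝ) • v i ∧ s ∈ D := by
      intro F
      by_cases hF : IsFacet L F
      · obtain ⟨s, ⟨j, hj⟩, hs⟩ := facet_point hL hz hF V hfree hmax
        obtain ⟨h1, h2⟩ := (hV _ _).1 hj
        exact ⟨s, _, j.1, fun _ => ⟨hs, h1, (sub_add_cancel _ _).symm, h2⟩⟩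
      · exact ⟨0, 0, 0, fun h => absurd h hF⟩
    choose s y n hsn using hpt
    have hinj : Set.InjOn (fun F => fun i => ((n F i : ℤ) : ZMod 2)) {F | IsFacet L F} := by
      intro F hF F' hF' heq
      by_contra hne
      obtain ⟨a1, a2, a3, a4⟩ := hsn F hF
      obtain ⟨b1, b2, b3, b4⟩ := hsn F' hF'
      have hint := midpoint_interior hL hz hF hF' a1 b1 hne
      have hpar : ∀ i, ∃ m : ℤ, n F i + n F' i = 2 * m := by
        intro i
        have h1 : ((n F i : ℤ) : ZMod 2) = ((n F' i : ℤ) : ZMod 2) := congrFun heq i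
        rw [ZMod.intCast_eq_intCast_iff, Int.ModEq] at h1
        exact ⟨(n F i + n F' i) / 2, by push_cast at h1; omega⟩
      choose m hm using hpar
      have hmem : (1/2 : ℝ) • (s F + s F') ∈ S := by
        rw [hS]
        constructor
        · refine ⟨(1/2 : ℝ) • y F + (1/2 : ℝ) • y F', hCc a2 b2 (by norm_num) (by norm_num) (by norm_num),
            ∑ i, (m i : ℝ) • v i, ?_, ?_⟩
          · rw [hΛ]; exact ⟨m, rfl⟩
          · have : ∑ i, (m i : ℝ) • v i = (1/2 : ℝ) • (∑ i, (n F i : ℝ) • v i + ∑ i, (n F' i : ℝ) • v i) := by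
              rw [← Finset.sum_add_distrib, Finset.smul_sum]
              refine Finset.sum_congr rfl fun i _ => ?_
              have h2 : (n F i : ℝ) + n F' i = 2 * m i := by exact_mod_cast hm i
              rw [← add_smul, h2, smul_smul]
              congr 1; ring
            simp only [this]
            rw [a3, b3]
            module
        · rw [smul_add]
          exact hDc a4 b4 (by norm_num) (by norm_num) (by norm_num)
      have : (1/2 : ℝ) • (s F + s F') ∈ interior L ∩ S := ⟨hint, hmem⟩
      rw [hLfree] at this
      exact this
    have := Set.encard_le_encard_of_injOn (t := Set.univ) (fun _ _ => Set.mem_univ _) hinj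
    refine this.trans (le_of_eq ?_)
    rw [Set.encard_univ, ENat.card_eq_coe_fintype_card]
    simp [ZMod.card]
end
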